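/- arXiv:2303.09784 — 2 statements merged into one kernel-verified Lean document; each statement's English description precedes it below -/
import Mathlib

section
/- Let T be a random map on (X, 𝒜, m) with parameter space (W, ν), and suppose T has a σ-finite invariant measure with density h with respect to m (i.e., the measure D ↦ ∫_D h dm satisfies P_*μ = μ). Let p̂ : X → (0,1] be measurable. Then the random map Υ_T = {T, id; p̂(x), 1−p̂(x)} with transition function P_Υ(x,D) = p̂(x)·∫_W p(t,x) 1_D(T_t(x)) ν(dt) + (1−p̂(x))·1_D(x) has the σ-finite invariant measure μ̂ given by μ̂(D) = ∫_D h(x)/p̂(x) m(dx); that is, ∫_X P_Υ(x,D) μ̂(dx) = μ̂(D) for all D ∈ 𝒜. -/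
open MeasureTheory Set ENNReal

/-- Lemma 2.1: if the random map `T = {T_t; p(t,x) : t ∈ W}` has a σ-finite
invariant measure with density `h` w.r.t. `m`, then the random map with the identity
`Υ_T = {T, id; p̂(x), 1 − p̂(x)}` has the σ-finite invariant measure with density `h/p̂`. -/
theorem stmt0
    {W X : Type*} [MeasurableSpace W] [MeasurableSpace X]
    (ν : Measure W) [SigmaFinite ν] (m : Measure X) [SigmaFinite m]
    (T : W → X → X) (hT : Measurable fun q : W × X => T q.1 q.2)
    (hTns : ∀ t, ∀ D : Set X, MeasurableSet D → m D = 0 → m (T t ⁻¹' D) = 0)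
    (p : W → X → ℝ≥0∞) (hp : Measurable fun q : W × X => p q.1 q.2)
    (hpfin : ∀ t x, p t x < ⊤)
    (hpP : ∀ x : X, ∫⁻ t, p t x ∂ν = 1)
    (h : X → ℝ≥0∞) (hh : Measurable h) [SigmaFinite (m.withDensity h)]
    (hinv : ∀ D : Set X, MeasurableSet D →
      ∫⁻ x, (∫⁻ t, p t x * D.indicator (fun _ => (1 : ℝ≥0∞)) (T t x) ∂ν)
          ∂(m.withDensity h) = m.withDensity h D)
    (phat : X → ℝ≥0∞) (hphat : Measurable phat)
    (hphat_pos : ∀ x, 0 < phat x) (hphat_le : ∀ x, phat x ≤ 1) :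
    SigmaFinite (m.withDensity fun x => h x / phat x) ∧
      ∀ D : Set X, MeasurableSet D →
        ∫⁻ x, (phat x * (∫⁻ t, p t x * D.indicator (fun _ => (1 : ℝ≥0∞)) (T t x) ∂ν)
              + (1 - phat x) * D.indicator (fun _ => (1 : ℝ≥0∞)) x)
            ∂(m.withDensity fun x => h x / phat x)
          = (m.withDensity fun x => h x / phat x) D := by
  have hphat_ne : ∀ x, phat x ≠ 0 := fun x => (hphat_pos x).ne'
  have hphat_top : ∀ x, phat x ≠ ⊤ := fun x => ((hphat_le x).trans_lt one_lt_top).ne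
  have hdens : (m.withDensity fun x => h x / phat x)
      = (m.withDensity h).withDensity fun x => (phat x)⁻¹ :=
    withDensity_mul m hh hphat.inv
  rw [hdens]
  refine ⟨SigmaFinite.withDensity_of_ne_top
    (Filter.Eventually.of_forall fun x => inv_ne_top.2 (hphat_ne x)), fun D hD => ?_⟩
  have hind : Measurable (D.indicator fun _ => (1 : ℝ≥0∞)) := measurable_const.indicator hD
  have hK : Measurable fun x =>
      ∫⁻ t, p t x * D.indicator (fun _ => (1 : ℝ≥0∞)) (T t x) ∂ν :=
    (hp.mul (hind.comp hT)).lintegral_prod_left'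
  have hsplit : ∀ x, ((fun x => (phat x)⁻¹) * fun x =>
        phat x * (∫⁻ t, p t x * D.indicator (fun _ => (1 : ℝ≥0∞)) (T t x) ∂ν)
          + (1 - phat x) * D.indicator (fun _ => (1 : ℝ≥0∞)) x) x
      = (∫⁻ t, p t x * D.indicator (fun _ => (1 : ℝ≥0∞)) (T t x) ∂ν)
        + (phat x)⁻¹ * ((1 - phat x) * D.indicator (fun _ => (1 : ℝ≥0∞)) x) := fun x => by
    rw [Pi.mul_apply, mul_add, ← mul_assoc,
      ENNReal.inv_mul_cancel (hphat_ne x) (hphat_top x), one_mul]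
  have hcombine : ∀ x, D.indicator (fun _ => (1 : ℝ≥0∞)) x
        + (phat x)⁻¹ * ((1 - phat x) * D.indicator (fun _ => (1 : ℝ≥0∞)) x)
      = D.indicator (fun x => (phat x)⁻¹) x := fun x => by
    by_cases hx : x ∈ D
    · simp only [indicator_of_mem hx, mul_one]
      calc 1 + (phat x)⁻¹ * (1 - phat x)
          = (phat x)⁻¹ * (phat x + (1 - phat x)) := by
            rw [mul_add, ENNReal.inv_mul_cancel (hphat_ne x) (hphat_top x)]
        _ = (phat x)⁻¹ := by rw [add_tsub_cancel_of_le (hphat_le x), mul_one]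
    · simp [indicator_of_notMem hx]
  refine (lintegral_withDensity_eq_lintegral_mul _ hphat.inv
    ((hphat.mul hK).add ((measurable_const.sub hphat).mul hind))).trans ?_
  refine (lintegral_congr hsplit).trans ?_
  rw [lintegral_add_left hK, hinv D hD, ← lintegral_indicator_one hD,
    withDensity_apply _ hD, ← lintegral_indicator hD, ← lintegral_congr hcombine]
  exact (lintegral_add_left hind _).symm
end

section
/- Let T be a random map on (X, 𝒜, m) with parameter space (W, ν), let A ⊂ X be measurable with m(A) > 0, and assume the first return random map R of T on A is well defined (Σ_{n≥1} p̂_n(x) = 1 for m-a.e. x ∈ A). Then the transition function of R satisfies P_R(x,D) = Σ_{n≥0} Ũ_T^n(U_T 1_D)(x) for every D ∈ 𝒜 with D ⊂ A and m-a.e. x ∈ A. -/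
open MeasureTheory Set ENNReal

noncomputable section

/-- Orbit of a point under successive application of the maps `S t` along a finite word of
parameters: `orbL S [t₁, …, t_k] x = S t_k (⋯ (S t₁ x))`. -/
def orbL {P α : Type*} (S : P → α → α) : List P → α → α
  | [], x => x
  | t :: ts, x => orbL S ts (S t x)

/-- The probability `p̂_n(x)` of first return to `A` after exactly `n` steps. -/
def firstReturnP {W X : Type*} [MeasurableSpace W] (ν : Measure W) [SigmaFinite ν]
    (T : W → X → X) (p : W → X → ℝ≥0∞) (A : Set X) (n : ℕ) (x : X) : ℝ≥0∞ :=
  ∫⁻ u : Fin n → W,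
    ∏ k : Fin n,
      (p (u k) (orbL T (List.take (k : ℕ) (List.ofFn u)) x) *
        Set.indicator (if (k : ℕ) + 1 < n then Aᶜ else A) (fun _ => (1 : ℝ≥0∞))
          (orbL T (List.take ((k : ℕ) + 1) (List.ofFn u)) x))
    ∂(Measure.pi fun _ : Fin n => ν)

/-- The transition function of the first return random map `R` of `T` on `A`:
`P_R(x,D) = Σ_{n≥1} ∫_{W^n} [Π_{k=1}^{n−1} p(t_k,x_{k−1}) 1_{X∖A}(x_k)]
  p(t_n,x_{n−1}) 1_A(x_n) 1_D(x_n) ν(dt₁)⋯ν(dt_n)`. -/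
def firstReturnTrans {W X : Type*} [MeasurableSpace W] (ν : Measure W) [SigmaFinite ν]
    (T : W → X → X) (p : W → X → ℝ≥0∞) (A : Set X) (x : X) (D : Set X) : ℝ≥0∞ :=
  ∑' n : ℕ,
    ∫⁻ u : Fin (n + 1) → W,
      ∏ k : Fin (n + 1),
        (p (u k) (orbL T (List.take (k : ℕ) (List.ofFn u)) x) *
          Set.indicator (if (k : ℕ) + 1 < n + 1 then Aᶜ else A ∩ D) (fun _ => (1 : ℝ≥0∞))
            (orbL T (List.take ((k : ℕ) + 1) (List.ofFn u)) x))
      ∂(Measure.pi fun _ : Fin (n + 1) => ν)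

theorem measurable_orbL_take_ofFn {W X : Type*} [MeasurableSpace W] [MeasurableSpace X]
    {T : W → X → X} (hT : Measurable fun q : W × X => T q.1 q.2) (n k : ℕ) :
    Measurable fun q : X × (Fin n → W) => orbL T (List.take k (List.ofFn q.2)) q.1 := by
  induction n generalizing k with
  | zero => simpa [orbL] using measurable_fst
  | succ n ih =>
    cases k with
    | zero => simpa [orbL] using measurable_fst
    | succ k =>
      simp only [List.ofFn_succ, List.take_succ_cons, orbL]
      have hfirst : Measurable fun q : X × (Fin (n + 1) → W) => T (q.2 0) q.1 :=
        hT.comp (f := fun q : X × (Fin (n + 1) → W) => (q.2 0, q.1)) (by fun_prop)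
      have htail : Measurable fun (q : X × (Fin (n + 1) → W)) (i : Fin n) => q.2 i.succ := by
        fun_prop
      exact (ih k).comp (hfirst.prodMk htail)

/-- The density of the event that the first `n` points of the orbit of `x` lie in `B` and the
point after them lies in `E`. -/
def pathWeight {W X : Type*} (T : W → X → X) (p : W → X → ℝ≥0∞) (B E : Set X) (n : ℕ) (x : X)
    (u : Fin (n + 1) → W) : ℝ≥0∞ :=
  ∏ k : Fin (n + 1),
    (p (u k) (orbL T (List.take (k : ℕ) (List.ofFn u)) x) *
      Set.indicator (if (k : ℕ) + 1 < n + 1 then B else E) (fun _ => (1 : ℝ≥0∞))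
        (orbL T (List.take ((k : ℕ) + 1) (List.ofFn u)) x))

theorem measurable_pathWeight {W X : Type*} [MeasurableSpace W] [MeasurableSpace X]
    {T : W → X → X} (hT : Measurable fun q : W × X => T q.1 q.2)
    {p : W → X → ℝ≥0∞} (hp : Measurable fun q : W × X => p q.1 q.2)
    {B E : Set X} (hB : MeasurableSet B) (hE : MeasurableSet E) (n : ℕ) :
    Measurable fun q : X × (Fin (n + 1) → W) => pathWeight T p B E n q.1 q.2 := by
  refine Finset.measurable_fun_prod _ fun k _ => Measurable.mul ?_ ?_
  · exact hp.comp (((measurable_pi_apply k).comp measurable_snd).prodMk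
      (measurable_orbL_take_ofFn hT _ _))
  · refine (measurable_const.indicator ?_).comp (measurable_orbL_take_ofFn hT _ _)
    split_ifs <;> assumption

theorem pathWeight_cons {W X : Type*} (T : W → X → X) (p : W → X → ℝ≥0∞) (B E : Set X) (n : ℕ)
    (x : X) (t : W) (u : Fin (n + 1) → W) :
    pathWeight T p B E (n + 1) x (Fin.cons t u) =
      p t x * B.indicator (fun _ => (1 : ℝ≥0∞)) (T t x) * pathWeight T p B E n (T t x) u := by
  rw [pathWeight, Fin.prod_univ_succ]
  simp [pathWeight, orbL]

theorem lintegral_pathWeight {W X : Type*} [MeasurableSpace W] [MeasurableSpace X]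
    (ν : Measure W) [SigmaFinite ν]
    {T : W → X → X} (hT : Measurable fun q : W × X => T q.1 q.2)
    {p : W → X → ℝ≥0∞} (hp : Measurable fun q : W × X => p q.1 q.2)
    {B E : Set X} (hB : MeasurableSet B) (hE : MeasurableSet E) (n : ℕ) (x : X) :
    ∫⁻ u, pathWeight T p B E n x u ∂(Measure.pi fun _ : Fin (n + 1) => ν) =
      (fun (f : X → ℝ≥0∞) => fun y => ∫⁻ t, p t y * (Set.indicator B f) (T t y) ∂ν)^[n]
        (fun y => ∫⁻ t, p t y * (Set.indicator E (fun _ => (1 : ℝ≥0∞))) (T t y) ∂ν) x := by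
  induction n generalizing x with
  | zero =>
    refine Eq.trans (lintegral_congr fun u => ?_)
      ((measurePreserving_funUnique ν (Fin 1)).lintegral_comp_emb
        (MeasurableEquiv.measurableEmbedding _)
        fun t => p t x * E.indicator (fun _ => (1 : ℝ≥0∞)) (T t x))
    simp [pathWeight, orbL]
  | succ n ih =>
    have hmeas := measurable_pathWeight hT hp hB hE
    rw [Function.iterate_succ_apply',
      ← ((measurePreserving_piFinSuccAbove (fun _ : Fin (n + 2) => ν) 0).symm _).lintegral_comp_emb
        (MeasurableEquiv.measurableEmbedding _), lintegral_prod]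
    · refine lintegral_congr fun t => ?_
      have hcons : ∀ u : Fin (n + 1) → W,
          (MeasurableEquiv.piFinSuccAbove (fun _ : Fin (n + 2) => W) 0).symm (t, u) =
            Fin.cons t u := fun u => by
        simp [MeasurableEquiv.piFinSuccAbove, Fin.consEquiv]
      simp only [hcons, pathWeight_cons]
      have hslice : Measurable (pathWeight T p B E n (T t x)) :=
        (hmeas n).comp measurable_prodMk_left
      rw [lintegral_const_mul _ hslice, ih, mul_assoc]
      by_cases h : T t x ∈ B <;> simp [h]
    · exact (((hmeas (n + 1)).comp measurable_prodMk_left).comp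
        (MeasurableEquiv.measurable _)).aemeasurable

/-- Proposition 3.1(iv): if the first return random map of `T` on `A` is
well defined then, for every measurable `D ⊆ A` and `m`-a.e. `x ∈ A`,
`P_R(x,D) = Σ_{n≥0} Ũ_T^n (U_T 1_D)(x)`. -/
theorem stmt3
    {W X : Type*} [MeasurableSpace W] [MeasurableSpace X]
    (ν : Measure W) [SigmaFinite ν] (m : Measure X) [SigmaFinite m]
    (T : W → X → X) (hT : Measurable fun q : W × X => T q.1 q.2)
    (hTns : ∀ t, ∀ D : Set X, MeasurableSet D → m D = 0 → m (T t ⁻¹' D) = 0)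
    (p : W → X → ℝ≥0∞) (hp : Measurable fun q : W × X => p q.1 q.2)
    (hpfin : ∀ t x, p t x < ⊤)
    (hpP : ∀ x : X, ∫⁻ t, p t x ∂ν = 1)
    (A : Set X) (hA : MeasurableSet A) (hApos : 0 < m A)
    (hwell : ∀ᵐ x ∂(m.restrict A), ∑' n : ℕ, firstReturnP ν T p A (n + 1) x = 1) :
    ∀ D : Set X, MeasurableSet D → D ⊆ A →
      ∀ᵐ x ∂(m.restrict A),
        firstReturnTrans ν T p A x D =
          ∑' n : ℕ,
            (fun (f : X → ℝ≥0∞) => fun y => ∫⁻ t, p t y * (Set.indicator Aᶜ f) (T t y) ∂ν)^[n]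
              (fun y => ∫⁻ t, p t y * (Set.indicator D (fun _ => (1 : ℝ≥0∞))) (T t y) ∂ν) x := by
  intro D hD hDA
  refine Filter.Eventually.of_forall fun x => ?_
  rw [firstReturnTrans, inter_eq_self_of_subset_right hDA]
  exact tsum_congr fun n => lintegral_pathWeight ν hT hp hA.compl hD n x
end
end
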